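/- arXiv:2412.19783 — 2 statements merged into one kernel-verified Lean document; each statement's English description precedes it below -/
import Mathlib

section
/- The polynomial C_n(x) = Σ_G x^{e(G)}, summing over all labeled connected simple graphs G on n vertices, has log-concave coefficients for all n ≥ 1. -/
/-- A polynomial has log-concave coefficients if `a_{i-1} * a_{i+1} ≤ a_i ^ 2` for all
interior indices (the inequality is trivial outside the support). -/
def PolyLogConcave (p : Polynomial ℤ) : Prop :=
  ∀ i : ℕ, p.coeff i * p.coeff (i + 2) ≤ p.coeff (i + 1) ^ 2

open scoped Classical in
/-- The edge enumerator of labeled connected simple graphs on `n` vertices. -/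
noncomputable def connPoly (n : ℕ) : Polynomial ℤ :=
  ∑ᶠ G : {G : SimpleGraph (Fin n) // G.Connected}, (Polynomial.X : Polynomial ℤ) ^ G.1.edgeFinset.card

open Matrix Finset

/-- The reverse Cauchy–Schwarz inequality for the quadratic form of `A` at `w`. -/
def IsHyperbolicAt {σ : Type*} [Fintype σ] (A : Matrix σ σ ℝ) (w : σ → ℝ) : Prop :=
  ∀ v : σ → ℝ, (v ⬝ᵥ A *ᵥ v) * (w ⬝ᵥ A *ᵥ w) ≤ (v ⬝ᵥ A *ᵥ w) ^ 2

section LinearAlgebra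

variable {σ : Type*} [Fintype σ] {A : Matrix σ σ ℝ} {w : σ → ℝ}

theorem Matrix.IsSymm.dotProduct_mulVec_comm (hA : A.IsSymm) (u v : σ → ℝ) :
    u ⬝ᵥ A *ᵥ v = v ⬝ᵥ A *ᵥ u := by
  rw [dotProduct_mulVec, ← mulVec_transpose, hA.eq, dotProduct_comm]

theorem isHyperbolicAt_of_ker (hA : A.IsSymm) (hw : 0 ≤ w ⬝ᵥ A *ᵥ w) (l : σ → ℝ)
    (hl : l ⬝ᵥ w ≠ 0 ∨ w ⬝ᵥ A *ᵥ w = 0) (h : ∀ v, l ⬝ᵥ v = 0 → v ⬝ᵥ A *ᵥ v ≤ 0) :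
    IsHyperbolicAt A w := by
  intro v
  rcases hw.eq_or_lt with h0 | hpos
  · rw [← h0, mul_zero]; positivity
  have hx : l ⬝ᵥ w ≠ 0 := hl.resolve_right hpos.ne'
  have key := h ((l ⬝ᵥ w) • v - (l ⬝ᵥ v) • w) (by
    simp only [dotProduct_sub, dotProduct_smul, smul_eq_mul]; ring)
  simp only [mulVec_sub, mulVec_smul, dotProduct_sub, sub_dotProduct, dotProduct_smul,
    smul_dotProduct, smul_eq_mul, hA.dotProduct_mulVec_comm w v] at key
  generalize l ⬝ᵥ w = x at *
  generalize l ⬝ᵥ v = y at *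
  generalize v ⬝ᵥ A *ᵥ v = a at *
  generalize v ⬝ᵥ A *ᵥ w = b at *
  generalize w ⬝ᵥ A *ᵥ w = c at *
  by_contra! hlt
  have hx2 : 0 < x ^ 2 := by positivity
  nlinarith [mul_pos hx2 (sub_pos.2 hlt), sq_nonneg (x * b - y * c),
    mul_nonneg hpos.le (neg_nonneg.2 key)]

theorem dotProduct_mulVec_nonpos_of_eigenvectors [DecidableEq σ] (hA : A.IsSymm) (y : σ → ℝ)
    (h : ∀ (μ : ℝ) (e : σ → ℝ), A *ᵥ e = μ • e → 0 < μ → e ⬝ᵥ y = 0) :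
    y ⬝ᵥ A *ᵥ y ≤ 0 := by
  have hH : A.IsHermitian := by
    rw [Matrix.IsHermitian, conjTranspose_eq_transpose_of_trivial]; exact hA
  set b := hH.eigenvectorBasis
  have hexp : ∀ x : EuclideanSpace ℝ σ, inner ℝ (WithLp.toLp 2 y) x =
      ∑ i, inner ℝ (WithLp.toLp 2 y) (b i) * inner ℝ (b i) x := fun x =>
    (b.sum_inner_mul_inner _ _).symm
  have hin : ∀ u v : σ → ℝ, inner ℝ (WithLp.toLp 2 u) (WithLp.toLp 2 v) = u ⬝ᵥ v := fun u v => by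
    rw [EuclideanSpace.inner_toLp_toLp]; simp [dotProduct_comm]
  have hbi : ∀ i, b i = WithLp.toLp 2 (b i).ofLp := fun i => rfl
  rw [← hin, hexp]
  refine Finset.sum_nonpos fun i _ => ?_
  have heig : A *ᵥ (b i).ofLp = hH.eigenvalues i • (b i).ofLp := hH.mulVec_eigenvectorBasis i
  rw [hbi i, hin, hin, hA.dotProduct_mulVec_comm, heig, dotProduct_smul, smul_eq_mul,
    dotProduct_comm y]
  rcases le_or_gt (hH.eigenvalues i) 0 with hle | hgt
  · nlinarith [mul_nonneg (neg_nonneg.2 hle) (mul_self_nonneg ((b i).ofLp ⬝ᵥ y))]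
  · rw [h _ _ heig hgt]; simp


theorem mulVec_apply_eq_zero_iff (hA0 : ∀ a b, 0 ≤ A a b) (hw : ∀ a, 0 < w a) (a : σ) :
    (A *ᵥ w) a = 0 ↔ ∀ b, A a b = 0 := by
  rw [mulVec, dotProduct, Finset.sum_eq_zero_iff_of_nonneg fun b _ => mul_nonneg (hA0 a b) (hw b).le]
  exact ⟨fun h b => (mul_eq_zero.1 (h b (mem_univ b))).resolve_right (hw b).ne',
    fun h b _ => by rw [h b, zero_mul]⟩

theorem mulVec_apply_nonneg (hA0 : ∀ a b, 0 ≤ A a b) (hw : ∀ a, 0 < w a) (a : σ) :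
    0 ≤ (A *ᵥ w) a :=
  Finset.sum_nonneg fun b _ => mul_nonneg (hA0 a b) (hw b).le

theorem sum_mul_sq_sub_eq (hA : A.IsSymm) (hw : ∀ a, 0 < w a) (v : σ → ℝ) :
    ∑ a, ∑ b, A a b * (w a * w b) * (v a / w a - v b / w b) ^ 2 =
      2 * (∑ a, (A *ᵥ w) a / w a * v a ^ 2 - v ⬝ᵥ A *ᵥ v) := by
  have hterm : ∀ a b, A a b * (w a * w b) * (v a / w a - v b / w b) ^ 2 =
      A a b * w b / w a * v a ^ 2 + A b a * w a / w b * v b ^ 2 - 2 * (v a * (A a b * v b)) := by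
    intro a b
    have ha := (hw a).ne'
    have hb := (hw b).ne'
    rw [hA.apply a b]
    field_simp
    ring
  have hsum : ∑ a, (A *ᵥ w) a / w a * v a ^ 2 = ∑ a, ∑ b, A a b * w b / w a * v a ^ 2 := by
    refine Finset.sum_congr rfl fun a _ => ?_
    rw [mulVec, dotProduct, Finset.sum_div, Finset.sum_mul]
  have hdot : v ⬝ᵥ A *ᵥ v = ∑ a, ∑ b, v a * (A a b * v b) := by
    simp only [dotProduct, mulVec, Finset.mul_sum]
  simp only [hterm, Finset.sum_add_distrib, Finset.sum_sub_distrib, ← Finset.mul_sum]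
  rw [Finset.sum_comm (f := fun a b => A b a * w a / w b * v b ^ 2), hsum, hdot]
  simp only [← Finset.mul_sum]
  ring

/-- A Perron–Frobenius argument: relative to the inner product with weights `(A w)ₐ / wₐ`, the
spectrum of the normalised matrix lies in `(-∞, 0] ∪ {1}`, and `1` is a simple eigenvalue. -/
theorem dotProduct_mulVec_nonpos_of_le (hA : A.IsSymm) (hA0 : ∀ a b, 0 ≤ A a b)
    (hw : ∀ a, 0 < w a) (o : σ) (ho : ∀ a, A o a = 0 → (A *ᵥ w) a = 0)
    (h : ∀ v, v ⬝ᵥ A *ᵥ v ≤ ∑ a, w a * ((A *ᵥ v) a ^ 2 / (A *ᵥ w) a))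
    (u : σ → ℝ) (hu : (A *ᵥ w) ⬝ᵥ u = 0) : u ⬝ᵥ A *ᵥ u ≤ 0 := by
  classical
  set r := A *ᵥ w with hr
  have hr0 : ∀ a, 0 ≤ r a := mulVec_apply_nonneg hA0 hw
  have hrA : ∀ a, r a = 0 → ∀ b, A b a = 0 := fun a ha b => by
    rw [hA.apply a b]; exact (mulVec_apply_eq_zero_iff hA0 hw a).1 ha b
  set s : σ → ℝ := fun a => √(w a / r a) with hs
  have hs2 : ∀ a, s a ^ 2 = w a / r a := fun a => Real.sq_sqrt (div_nonneg (hw a).le (hr0 a))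
  set B : Matrix σ σ ℝ := of fun a b => s a * A a b * s b with hB
  have hBs : B.IsSymm := by
    ext a b
    simp only [hB, transpose_apply, of_apply, hA.apply a b]
    ring
  have hBv : ∀ e a, (B *ᵥ e) a = s a * (A *ᵥ (s * e)) a := fun e a => by
    simp only [hB, mulVec, dotProduct, of_apply, Finset.mul_sum, Pi.mul_apply]
    exact Finset.sum_congr rfl fun b _ => by ring
  have hBq : ∀ e, e ⬝ᵥ B *ᵥ e = (s * e) ⬝ᵥ A *ᵥ (s * e) := fun e => by
    simp only [dotProduct, hBv, Pi.mul_apply]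
    exact Finset.sum_congr rfl fun b _ => by ring
  -- the vector corresponding to `u` after normalisation
  set y : σ → ℝ := fun a => u a / s a with hy
  have hs0 : ∀ a, 0 < r a → s a ≠ 0 := fun a ha => (Real.sqrt_pos.2 (div_pos (hw a) ha)).ne'
  have hAy : A *ᵥ (s * y) = A *ᵥ u := by
    ext a
    refine Finset.sum_congr rfl fun b _ => ?_
    rcases (hr0 b).eq_or_lt with h0 | hpos
    · simp [hrA b h0.symm a]
    · rw [hy, Pi.mul_apply, mul_div_cancel₀ _ (hs0 b hpos)]
  have hyu : (s * y) ⬝ᵥ A *ᵥ (s * y) = u ⬝ᵥ A *ᵥ u := by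
    rw [hAy, hA.dotProduct_mulVec_comm, hAy]
  rw [← hyu, ← hBq]
  refine dotProduct_mulVec_nonpos_of_eigenvectors hBs y fun μ e he hμ => ?_
  have hea : ∀ a, s a * (A *ᵥ (s * e)) a = μ * e a := fun a => by rw [← hBv, he]; simp
  have hquad : (s * e) ⬝ᵥ A *ᵥ (s * e) = μ * ∑ a, e a ^ 2 := by
    rw [← hBq, he, dotProduct_smul, smul_eq_mul, dotProduct]
    simp only [sq]
  have hle2 : μ * ∑ a, e a ^ 2 ≤ μ ^ 2 * ∑ a, e a ^ 2 := by
    rw [← hquad, Finset.mul_sum]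
    refine (h _).trans_eq (Finset.sum_congr rfl fun a _ => ?_)
    rw [← mul_pow, ← hea a, mul_pow, hs2 a]
    ring
  have hsum : ∑ a, r a / w a * (s * e) a ^ 2 ≤ ∑ a, e a ^ 2 := by
    refine Finset.sum_le_sum fun a _ => ?_
    rw [Pi.mul_apply, mul_pow, hs2, ← mul_assoc]
    rcases (hr0 a).eq_or_lt with h0 | hpos
    · simp only [← h0]; simp; positivity
    · have := (hw a).ne'
      have := hpos.ne'
      apply le_of_eq
      field_simp
  have hterm0 : ∀ a b, 0 ≤ A a b * (w a * w b) * ((s * e) a / w a - (s * e) b / w b) ^ 2 :=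
    fun a b => mul_nonneg (mul_nonneg (hA0 a b) (mul_pos (hw a) (hw b)).le) (sq_nonneg _)
  have hdir := sum_mul_sq_sub_eq hA hw (s * e)
  rw [hquad, ← hr] at hdir
  rcases (Finset.sum_nonneg fun a _ => sq_nonneg (e a) : 0 ≤ ∑ a, e a ^ 2).eq_or_lt with hE | hE
  · have : ∀ a, e a = 0 := fun a => by
      have := (Finset.sum_eq_zero_iff_of_nonneg fun a _ => sq_nonneg (e a)).1 hE.symm a (mem_univ a)
      exact pow_eq_zero_iff two_ne_zero |>.1 this
    simp [dotProduct, this]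
  have hμ1 : 1 ≤ μ := by
    have : μ ≤ μ ^ 2 := le_of_mul_le_mul_right hle2 hE
    nlinarith
  -- equality in the Dirichlet form forces `e` to be proportional to the Perron vector
  have hconst : ∀ a b, A a b * (w a * w b) * ((s * e) a / w a - (s * e) b / w b) ^ 2 = 0 := by
    have hz : ∑ a, ∑ b, A a b * (w a * w b) * ((s * e) a / w a - (s * e) b / w b) ^ 2 = 0 := by
      refine le_antisymm ?_ (Finset.sum_nonneg fun a _ => Finset.sum_nonneg fun b _ => hterm0 a b)
      rw [hdir]
      nlinarith
    intro a b
    have h1 := (Finset.sum_eq_zero_iff_of_nonneg fun a _ =>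
      Finset.sum_nonneg fun b _ => hterm0 a b).1 hz a (mem_univ a)
    exact (Finset.sum_eq_zero_iff_of_nonneg fun b _ => hterm0 a b).1 h1 b (mem_univ b)
  have hey : ∀ a, e a * y a = (s * e) o / w o * (r a * u a) := by
    intro a
    rcases (hr0 a).eq_or_lt with h0 | hpos
    · simp [hy, hs, ← h0]
    · have hoa : A o a ≠ 0 := fun h0 => hpos.ne' (ho a h0)
      have heq : (s * e) o / w o = (s * e) a / w a := by
        have := hconst o a
        have hne : A o a * (w o * w a) ≠ 0 := mul_ne_zero hoa (mul_pos (hw o) (hw a)).ne'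
        exact sub_eq_zero.1 (pow_eq_zero_iff two_ne_zero |>.1 ((mul_eq_zero.1 this).resolve_left hne))
      have hsa := hs0 a hpos
      have hrs : r a * s a ^ 2 = w a := by rw [hs2, mul_div_cancel₀ _ hpos.ne']
      rw [heq, hy, Pi.mul_apply, ← hrs]
      have := hpos.ne'
      field_simp
  rw [dotProduct, Finset.sum_congr rfl fun a _ => hey a, ← Finset.mul_sum]
  rw [dotProduct] at hu
  rw [hu, mul_zero]

end LinearAlgebra

section IteratedSums

variable {σ : Type*} [Fintype σ]

/-- The `m`-fold sum of `c` over all ways of adjoining `m` elements to a multiset, each weighted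
by `w`. -/
def iterSum (c : Multiset σ → ℝ) (w : σ → ℝ) : ℕ → Multiset σ → ℝ
  | 0, T => c T
  | m + 1, T => ∑ a, w a * iterSum c w m (a ::ₘ T)

/-- The matrix of second differences of `iterSum`. If `c` lists the partial derivatives of a
homogeneous polynomial, this is a multiple of its Hessian at `w`. -/
def iterHess (c : Multiset σ → ℝ) (w : σ → ℝ) (m : ℕ) (T : Multiset σ) : Matrix σ σ ℝ :=
  of fun a b => iterSum c w m (a ::ₘ b ::ₘ T)

variable {c : Multiset σ → ℝ} {w : σ → ℝ}

theorem iterSum_nonneg (hc : ∀ T, 0 ≤ c T) (hw : ∀ a, 0 < w a) (m : ℕ) (T : Multiset σ) :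
    0 ≤ iterSum c w m T := by
  induction m generalizing T with
  | zero => exact hc T
  | succ m ih => exact Finset.sum_nonneg fun a _ => mul_nonneg (hw a).le (ih _)

theorem iterHess_isSymm (m : ℕ) (T : Multiset σ) : (iterHess c w m T).IsSymm := by
  ext a b
  simp only [iterHess, transpose_apply, of_apply, Multiset.cons_swap a b]

theorem iterHess_mulVec (m : ℕ) (T : Multiset σ) (a : σ) :
    (iterHess c w m T *ᵥ w) a = iterSum c w (m + 1) (a ::ₘ T) := by
  simp only [mulVec, dotProduct, iterHess, of_apply, iterSum]
  exact Finset.sum_congr rfl fun b _ => by rw [mul_comm, Multiset.cons_swap]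

theorem dotProduct_iterHess_mulVec (m : ℕ) (T : Multiset σ) :
    w ⬝ᵥ iterHess c w m T *ᵥ w = iterSum c w (m + 2) T := by
  simp only [dotProduct, iterHess_mulVec]
  rfl

theorem iterHess_succ (m : ℕ) (T : Multiset σ) :
    iterHess c w (m + 1) T = ∑ a, w a • iterHess c w m (a ::ₘ T) := by
  ext x y
  simp only [iterHess, of_apply, iterSum, Matrix.sum_apply, Matrix.smul_apply, smul_eq_mul]
  refine Finset.sum_congr rfl fun a _ => ?_
  rw [Multiset.cons_swap a x, Multiset.cons_swap a y]

/-- Hyperbolicity passes from all the derivatives to the polynomial itself. -/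
theorem isHyperbolicAt_iterHess (hc : ∀ T, 0 ≤ c T) (hw : ∀ a, 0 < w a) (o : σ)
    (ho : ∀ m T, iterSum c w m (o ::ₘ T) = 0 → iterSum c w (m + 1) T = 0)
    (hbase : ∀ T, IsHyperbolicAt (iterHess c w 0 T) w) (m : ℕ) (T : Multiset σ) :
    IsHyperbolicAt (iterHess c w m T) w := by
  induction m generalizing T with
  | zero => exact hbase T
  | succ m ih =>
    have hA0 : ∀ m T a b, 0 ≤ iterHess c w m T a b := fun m T a b => iterSum_nonneg hc hw _ _
    have hsymm := iterHess_isSymm (c := c) (w := w) (m + 1) T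
    have hww : 0 ≤ w ⬝ᵥ iterHess c w (m + 1) T *ᵥ w := by
      rw [dotProduct_iterHess_mulVec]; exact iterSum_nonneg hc hw _ _
    have hrow : ∀ a v, v ⬝ᵥ iterHess c w m (a ::ₘ T) *ᵥ w = (iterHess c w (m + 1) T *ᵥ v) a := by
      intro a v
      simp only [dotProduct, iterHess_mulVec]
      exact Finset.sum_congr rfl fun b _ => by rw [mul_comm, Multiset.cons_swap]; rfl
    refine isHyperbolicAt_of_ker hsymm hww (iterHess c w (m + 1) T *ᵥ w) ?_ ?_
    · rw [dotProduct_comm]; exact (em _).symm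
    refine fun u hu => dotProduct_mulVec_nonpos_of_le hsymm (hA0 _ _) hw o (fun a ha => ?_)
      (fun v => ?_) u hu
    · rw [iterHess_mulVec]
      exact ho _ _ ha
    · have hsum : v ⬝ᵥ iterHess c w (m + 1) T *ᵥ v =
          ∑ a, v ⬝ᵥ (w a • iterHess c w m (a ::ₘ T)) *ᵥ v := by
        rw [iterHess_succ, Matrix.sum_mulVec, dotProduct_sum]
      rw [hsum]
      refine Finset.sum_le_sum fun a _ => ?_
      rw [smul_mulVec, dotProduct_smul, smul_eq_mul]
      refine mul_le_mul_of_nonneg_left ?_ (hw a).le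
      have h := ih (a ::ₘ T) v
      rw [hrow, hrow] at h
      rcases (mulVec_apply_nonneg (hA0 (m + 1) T) hw a).eq_or_lt with h0 | hpos
      · have hzero : iterHess c w m (a ::ₘ T) = 0 := by
          ext b d
          refine (mulVec_apply_eq_zero_iff (hA0 m (a ::ₘ T)) hw b).1 ?_ d
          rw [iterHess_mulVec]
          have := (mulVec_apply_eq_zero_iff (hA0 (m + 1) T) hw a).1 h0.symm b
          rwa [iterHess, of_apply, Multiset.cons_swap] at this
        simp [hzero, ← h0]
      · rwa [le_div_iff₀ hpos]

end IteratedSums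

section Matroidal

variable {α : Type*} [DecidableEq α]

/-- A hereditary family of finite sets in which, in every link, being parallel is transitive.
This is a local form of the exchange axiom for the independent sets of a matroid. -/
structure IsMatroidal (F : Finset α → Prop) : Prop where
  mono : ∀ ⦃I J⦄, I ⊆ J → F J → F I
  exchange : ∀ ⦃S i j k⦄, i ∉ S → j ∉ S → k ∉ S → i ≠ j → j ≠ k → i ≠ k →
    F (insert j S) → F (insert i (insert k S)) →
    F (insert i (insert j S)) ∨ F (insert j (insert k S))

open scoped Classical in
/-- The indicator of `F` on multisets, where `none` plays the role of a dummy element that may be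
repeated freely. -/
noncomputable def memInd (F : Finset α → Prop) (T : Multiset (Option α)) : ℝ :=
  if (T.filterMap id).Nodup ∧ F (T.filterMap id).toFinset then 1 else 0

variable {F : Finset α → Prop}

theorem memInd_nonneg (T : Multiset (Option α)) : 0 ≤ memInd F T := by
  unfold memInd; split_ifs <;> norm_num

theorem memInd_none_cons (T : Multiset (Option α)) : memInd F (none ::ₘ T) = memInd F T := by
  rw [memInd, memInd, Multiset.filterMap_cons_none _ _ rfl]

theorem IsMatroidal.memInd_cons_eq_zero (hF : IsMatroidal F) {T : Multiset (Option α)}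
    (hT : memInd F T = 0) (a : Option α) : memInd F (a ::ₘ T) = 0 := by
  cases a with
  | none => rwa [memInd_none_cons]
  | some i =>
    simp only [memInd, ite_eq_right_iff, one_ne_zero, imp_false, not_and] at hT ⊢
    rw [Multiset.filterMap_cons_some id (some i) T rfl, Multiset.nodup_cons,
      Multiset.toFinset_cons]
    exact fun h1 h2 => hT h1.2 (hF.mono (Finset.subset_insert _ _) h2)

variable [Fintype α]

theorem iterSum_memInd_none_cons (w : Option α → ℝ) (m : ℕ) (T : Multiset (Option α)) :
    iterSum (memInd F) w m (none ::ₘ T) = iterSum (memInd F) w m T := by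
  induction m generalizing T with
  | zero => exact memInd_none_cons T
  | succ m ih =>
    refine Finset.sum_congr rfl fun a _ => ?_
    rw [Multiset.cons_swap, ih]

theorem IsMatroidal.iterSum_eq_zero (hF : IsMatroidal F) (w : Option α → ℝ) (m : ℕ)
    {T : Multiset (Option α)} (hT : memInd F T = 0) : iterSum (memInd F) w m T = 0 := by
  induction m generalizing T with
  | zero => exact hT
  | succ m ih =>
    exact Finset.sum_eq_zero fun a _ => by rw [ih (hF.memInd_cons_eq_zero hT a), mul_zero]

theorem IsMatroidal.iterSum_succ_eq_zero (hF : IsMatroidal F) {w : Option α → ℝ}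
    (hw : ∀ a, 0 < w a) (m : ℕ) (T : Multiset (Option α))
    (hT : iterSum (memInd F) w m (none ::ₘ T) = 0) : iterSum (memInd F) w (m + 1) T = 0 := by
  refine hF.iterSum_eq_zero w _ ?_
  rw [iterSum_memInd_none_cons] at hT
  induction m with
  | zero => exact hT
  | succ m ih =>
    refine ih ?_
    have h := (Finset.sum_eq_zero_iff_of_nonneg fun a _ =>
      mul_nonneg (hw a).le (iterSum_nonneg memInd_nonneg hw m _)).1 hT none (mem_univ _)
    rw [iterSum_memInd_none_cons] at h
    exact (mul_eq_zero.1 h).resolve_left (hw none).ne'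

theorem dotProduct_vecMulVec_mulVec_self {σ : Type*} [Fintype σ] (x v : σ → ℝ) :
    v ⬝ᵥ vecMulVec x x *ᵥ v = (x ⬝ᵥ v) ^ 2 := by
  rw [vecMulVec_mulVec, dotProduct_comm v]
  simp [sq]

theorem IsMatroidal.isHyperbolicAt_iterHess_zero (hF : IsMatroidal F) {w : Option α → ℝ}
    (hw : ∀ a, 0 < w a) (T : Multiset (Option α)) :
    IsHyperbolicAt (iterHess (memInd F) w 0 T) w := by
  classical
  by_cases hT : memInd F T = 0
  · have hzero : iterHess (memInd F) w 0 T = 0 := by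
      ext a b
      exact hF.memInd_cons_eq_zero (hF.memInd_cons_eq_zero hT b) a
    intro v
    simp [hzero]
  have hww : 0 ≤ w ⬝ᵥ iterHess (memInd F) w 0 T *ᵥ w := by
    rw [dotProduct_iterHess_mulVec]; exact iterSum_nonneg memInd_nonneg hw _ _
  have hmem : (T.filterMap id).Nodup ∧ F (T.filterMap id).toFinset := by
    by_contra h; exact hT (if_neg h)
  obtain ⟨hnd, hFS⟩ := hmem
  set S := (T.filterMap id).toFinset with hS
  have hiS : ∀ i, i ∈ T.filterMap id ↔ i ∈ S := fun i => by rw [hS, Multiset.mem_toFinset]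
  let N : α → Prop := fun i => i ∉ S ∧ F (insert i S)
  let par : α → Finset α := fun i => {j | N j ∧ (i = j ∨ ¬ F (insert i (insert j S)))}
  have hpar : ∀ i j, N i → N j → (par i = par j ↔ i = j ∨ ¬ F (insert i (insert j S))) := by
    have hsymm : ∀ i j, (i = j ∨ ¬ F (insert i (insert j S))) →
        (j = i ∨ ¬ F (insert j (insert i S))) := fun i j h => by
      rwa [eq_comm, Finset.insert_comm]
    have htrans : ∀ i j k, N i → N j → N k → (i = j ∨ ¬ F (insert i (insert j S))) →
        (j = k ∨ ¬ F (insert j (insert k S))) → (i = k ∨ ¬ F (insert i (insert k S))) := by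
      intro i j k hi hj hk hij hjk
      by_contra! h
      rcases hij with rfl | hij
      · exact hjk.elim h.1 fun h' => h' h.2
      rcases hjk with rfl | hjk
      · exact hij h.2
      have hne : ∀ {x y}, N x → ¬ F (insert x (insert y S)) → N y → x ≠ y := by
        rintro x _ hx hxy - rfl
        exact hxy (by simpa using hx.2)
      exact (hF.exchange hi.1 hj.1 hk.1 (hne hi hij hj) (hne hj hjk hk) h.1 hj.2 h.2).elim hij hjk
    intro i j hi hj
    refine ⟨fun h => ?_, fun h => ?_⟩
    · have hmem : j ∈ par j := by simp [par, hj]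
      rw [← h] at hmem
      exact (Finset.mem_filter.1 hmem).2.2
    · ext k
      simp only [par, Finset.mem_filter, Finset.mem_univ, true_and]
      exact and_congr_right fun hk => ⟨htrans j i k hj hi hk (hsymm i j h), htrans i j k hi hj hk h⟩
  let l : Option α → ℝ := fun a => a.elim 1 fun i => if N i then 1 else 0
  let χ : Finset α → Option α → ℝ := fun P a => a.elim 0 fun i => if N i ∧ par i = P then 1 else 0
  have hH : iterHess (memInd F) w 0 T = vecMulVec l l - ∑ P, vecMulVec (χ P) (χ P) := by
    ext a b
    have hsum : ∀ i j, ∑ P, χ P (some i) * χ P (some j) =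
        if N i ∧ N j ∧ par i = par j then 1 else 0 := by
      intro i j
      rw [Finset.sum_eq_single (par i)]
      · simp only [χ, Option.elim]; grind
      · intro P _ hP; simp only [χ, Option.elim]; grind
      · simp
    have hsome : ∀ i, memInd F (some i ::ₘ T) = if N i then 1 else 0 := fun i => by
      rw [memInd, Multiset.filterMap_cons_some id (some i) _ rfl]
      simp only [Multiset.nodup_cons, Multiset.toFinset_cons, hiS, ← hS, hnd, and_true, N]
    have hT1 : memInd F T = 1 := if_pos ⟨hnd, hFS⟩
    simp only [iterHess, of_apply, iterSum, Matrix.sub_apply, Matrix.sum_apply, vecMulVec_apply]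
    rcases a with _ | i <;> rcases b with _ | j
    · simp [memInd_none_cons, hT1, l, χ]
    · simp [memInd_none_cons, hsome, l, χ]
    · simp [Multiset.cons_swap (some i), memInd_none_cons, hsome, l, χ]
    · rw [hsum, memInd, Multiset.filterMap_cons_some id (some i) _ rfl,
        Multiset.filterMap_cons_some id (some j) _ rfl]
      simp only [Multiset.nodup_cons, Multiset.toFinset_cons, Multiset.mem_cons, hiS, ← hS, l,
        Option.elim, hnd, and_true]
      by_cases hi : N i
      · by_cases hj : N j
        · have hpij := hpar i j hi hj
          have hi1 := hi.1
          have hj1 := hj.1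
          grind
        · rw [if_neg fun h => hj ⟨h.1.2, hF.mono (Finset.subset_insert _ _) h.2⟩]
          simp [hj]
      · rw [if_neg fun h => hi ⟨fun hiS => h.1.1 (Or.inr hiS),
          hF.mono (Finset.insert_subset_insert _ (Finset.subset_insert _ _)) h.2⟩]
        simp [hi]
  refine isHyperbolicAt_of_ker (iterHess_isSymm 0 T) hww l (Or.inl (ne_of_gt ?_)) fun v hv => ?_
  · have hl : ∀ a, 0 ≤ l a := by
      rintro (_ | i)
      · exact zero_le_one
      · simp only [l, Option.elim]; split_ifs <;> norm_num
    refine Finset.sum_pos' (fun a _ => mul_nonneg (hl a) (hw a).le) ⟨none, mem_univ _, ?_⟩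
    simpa [l] using hw none
  · rw [hH, sub_mulVec, dotProduct_sub, Matrix.sum_mulVec, dotProduct_sum,
      dotProduct_vecMulVec_mulVec_self, hv]
    simp only [dotProduct_vecMulVec_mulVec_self]
    have := Finset.sum_nonneg fun P (_ : P ∈ univ) => sq_nonneg (χ P ⬝ᵥ v)
    linarith

theorem IsMatroidal.iterSum_mul_le (hF : IsMatroidal F) {w : Option α → ℝ}
    (hw : ∀ a, 0 < w a) (m : ℕ) :
    iterSum (memInd F) w m 0 * iterSum (memInd F) w (m + 2) 0 ≤
      iterSum (memInd F) w (m + 1) 0 ^ 2 := by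
  have h := isHyperbolicAt_iterHess memInd_nonneg hw none (hF.iterSum_succ_eq_zero hw)
    (hF.isHyperbolicAt_iterHess_zero hw) m 0 (Pi.single none 1)
  rw [dotProduct_iterHess_mulVec, single_one_dotProduct, single_one_dotProduct, iterHess_mulVec,
    iterSum_memInd_none_cons, mulVec_single_one] at h
  simpa only [iterHess, col_apply, of_apply, iterSum_memInd_none_cons] using h

/-- The weights specialising all elements to `1` and the dummy element to `t`. -/
def dummyWeight (t : ℝ) : Option α → ℝ := fun a => a.elim t fun _ => 1

theorem continuous_iterSum_dummyWeight (m : ℕ) (T : Multiset (Option α)) :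
    Continuous fun t => iterSum (memInd F) (dummyWeight t) m T := by
  induction m generalizing T with
  | zero => exact continuous_const
  | succ m ih =>
    refine continuous_finsetSum _ fun a _ => Continuous.mul ?_ (ih _)
    cases a
    · exact continuous_id
    · exact continuous_const

open scoped Classical in
theorem IsMatroidal.iterSum_dummyWeight_zero (hF : IsMatroidal F) (m : ℕ) (S : Finset α) :
    iterSum (memInd F) (dummyWeight 0) m (S.val.map some) =
      m.factorial * #{I : Finset α | F I ∧ S ⊆ I ∧ #I = #S + m} := by
  have hfm : ∀ S : Finset α, (S.val.map some).filterMap id = S.val := fun S => by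
    rw [Multiset.filterMap_map]; exact Multiset.filterMap_some _
  induction m generalizing S with
  | zero =>
    have : ({I : Finset α | F I ∧ S ⊆ I ∧ #I = #S + 0} : Finset (Finset α)) =
        if F S then {S} else ∅ := by
      ext I
      have : S ⊆ I ∧ #I = #S + 0 ↔ I = S :=
        ⟨fun h => (Finset.eq_of_subset_of_card_le h.1 h.2.le).symm, by rintro rfl; simp⟩
      rw [Finset.mem_filter, this]
      split_ifs <;> aesop
    rw [this]
    simp only [iterSum, memInd, hfm, S.nodup, true_and, Finset.val_toFinset]
    split_ifs <;> simp
  | succ m ih =>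
    have hstep : ∀ i, iterSum (memInd F) (dummyWeight 0) m (some i ::ₘ S.val.map some) =
        m.factorial * #{I : Finset α | (F I ∧ S ⊆ I ∧ #I = #S + (m + 1)) ∧ i ∈ I \ S} := by
      intro i
      by_cases hi : i ∈ S
      · rw [hF.iterSum_eq_zero]
        · simp [hi]
        · rw [memInd, if_neg]
          rw [Multiset.filterMap_cons_some id (some i) _ rfl, hfm]
          simp [hi]
      · have := ih (insert i S)
        rw [Finset.insert_val_of_notMem hi, Multiset.map_cons] at this
        rw [this, Finset.card_insert_of_notMem hi]
        congr 3
        ext I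
        simp only [Finset.mem_filter, Finset.mem_univ, true_and, Finset.insert_subset_iff,
          Finset.mem_sdiff]
        grind
    rw [iterSum, Fintype.sum_option]
    simp only [dummyWeight, Option.elim, zero_mul, zero_add, one_mul]
    have hcount : ∑ i, #{I : Finset α | (F I ∧ S ⊆ I ∧ #I = #S + (m + 1)) ∧ i ∈ I \ S} =
        #{I : Finset α | F I ∧ S ⊆ I ∧ #I = #S + (m + 1)} * (m + 1) := by
      simp only [Finset.card_filter _ univ, Finset.sum_mul]
      rw [Finset.sum_comm]
      refine Finset.sum_congr rfl fun I _ => ?_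
      by_cases hI : F I ∧ S ⊆ I ∧ #I = #S + (m + 1)
      · simp only [hI, and_self, true_and, ← Finset.card_filter, if_true, one_mul]
        rw [Finset.filter_univ_mem, Finset.card_sdiff_of_subset hI.2.1, hI.2.2]
        omega
      · simp [hI]
    refine (Finset.sum_congr rfl fun i _ => hstep i).trans ?_
    rw [← Finset.mul_sum, ← Nat.cast_sum, hcount, Nat.factorial_succ]
    push_cast
    ring

/-- Log-concavity of the numbers of independent sets of a matroid. -/
theorem IsMatroidal.ncard_mul_ncard_le (hF : IsMatroidal F) (m : ℕ) :
    {I | F I ∧ #I = m}.ncard * {I | F I ∧ #I = m + 2}.ncard ≤ {I | F I ∧ #I = m + 1}.ncard ^ 2 := by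
  classical
  have hncard : ∀ k, {I | F I ∧ #I = k}.ncard = #{I : Finset α | F I ∧ #I = k} := fun k => by
    rw [← Set.ncard_coe_finset]; simp
  rw [hncard, hncard, hncard]
  have hlim : iterSum (memInd F) (dummyWeight 0) m 0 * iterSum (memInd F) (dummyWeight 0) (m + 2) 0 ≤
      iterSum (memInd F) (dummyWeight 0) (m + 1) 0 ^ 2 := by
    have hcont := fun k => continuous_iterSum_dummyWeight (F := F) k 0
    refine le_of_tendsto_of_tendsto
      ((((hcont m).mul (hcont (m + 2))).tendsto 0).mono_left nhdsWithin_le_nhds)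
      ((((hcont (m + 1)).pow 2).tendsto 0).mono_left nhdsWithin_le_nhds)
      (Filter.eventually_of_mem (self_mem_nhdsWithin (s := Set.Ioi 0)) fun t ht =>
        hF.iterSum_mul_le (fun a => ?_) m)
    cases a
    · exact ht
    · exact zero_lt_one
  have hval := fun k => hF.iterSum_dummyWeight_zero k ∅
  simp only [Finset.empty_val, Multiset.map_zero, Finset.empty_subset, true_and,
    Finset.card_empty, zero_add] at hval
  rw [hval, hval, hval] at hlim
  have hnat : m.factorial * #{I : Finset α | F I ∧ #I = m} *
      ((m + 2).factorial * #{I : Finset α | F I ∧ #I = m + 2}) ≤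
      ((m + 1).factorial * #{I : Finset α | F I ∧ #I = m + 1}) ^ 2 := by exact_mod_cast hlim
  have hpos : 0 < m.factorial * (m + 1).factorial * (m + 1) := by positivity
  refine Nat.le_of_mul_le_mul_left ?_ hpos
  rw [Nat.factorial_succ (m + 1)] at hnat
  rw [Nat.factorial_succ m] at hnat ⊢
  nlinarith [Nat.zero_le (m.factorial * (m.factorial * (m + 1)) *
    (#{I : Finset α | F I ∧ #I = m} * #{I : Finset α | F I ∧ #I = m + 2}))]

end Matroidal

section Connected

variable {V : Type*}

namespace SimpleGraph

theorem Reachable.of_fromEdgeSet_insert {E : Set (Sym2 V)} {a b x y : V}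
    (h : (fromEdgeSet (insert s(a, b) E)).Reachable x y) :
    (fromEdgeSet E).Reachable x y ∨
      (fromEdgeSet E).Reachable x a ∧ (fromEdgeSet E).Reachable b y ∨
      (fromEdgeSet E).Reachable x b ∧ (fromEdgeSet E).Reachable a y := by
  rw [reachable_iff_reflTransGen] at h
  induction h with
  | refl => exact Or.inl (Reachable.refl x)
  | @tail y z _ hyz ih =>
    rw [fromEdgeSet_adj, Set.mem_insert_iff] at hyz
    obtain ⟨heq | hE, hne⟩ := hyz
    · rw [Sym2.eq_iff] at heq
      obtain ⟨rfl, rfl⟩ | ⟨rfl, rfl⟩ := heq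
      · rcases ih with h | h | h
        · exact Or.inr (Or.inl ⟨h, Reachable.refl _⟩)
        · exact Or.inr (Or.inl ⟨h.1, Reachable.refl _⟩)
        · exact Or.inl h.1
      · rcases ih with h | h | h
        · exact Or.inr (Or.inr ⟨h, Reachable.refl _⟩)
        · exact Or.inl h.1
        · exact Or.inr (Or.inr ⟨h.1, Reachable.refl _⟩)
    · have hyz : (fromEdgeSet E).Reachable y z := Adj.reachable ⟨hE, hne⟩
      rcases ih with h | h | h
      · exact Or.inl (h.trans hyz)
      · exact Or.inr (Or.inl ⟨h.1, h.2.trans hyz⟩)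
      · exact Or.inr (Or.inr ⟨h.1, h.2.trans hyz⟩)

/-- Exchange for connected spanning subgraphs. -/
theorem Connected.fromEdgeSet_insert_exchange {E : Set (Sym2 V)} {e f g : Sym2 V}
    (h₁ : (fromEdgeSet (insert e (insert g E))).Connected)
    (h₂ : (fromEdgeSet (insert f E)).Connected) :
    (fromEdgeSet (insert g E)).Connected ∨ (fromEdgeSet (insert e E)).Connected := by
  have := h₁.nonempty
  induction f with | _ a b
  induction g with | _ u v
  by_cases huv : (fromEdgeSet E).Reachable u v
  · refine Or.inr ⟨fun x y => ?_⟩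
    have huv' := huv.mono (fromEdgeSet_mono (Set.subset_insert e E))
    have hxy := h₁.preconnected x y
    rw [Set.insert_comm] at hxy
    rcases hxy.of_fromEdgeSet_insert with h | h | h
    · exact h
    · exact (h.1.trans huv').trans h.2
    · exact (h.1.trans huv'.symm).trans h.2
  · refine Or.inl ?_
    have hab : ∀ x, (fromEdgeSet E).Reachable x a ∨ (fromEdgeSet E).Reachable x b := fun x => by
      rcases (h₂.preconnected x a).of_fromEdgeSet_insert with h | h | h
      · exact Or.inl h
      · exact Or.inl h.1
      · exact Or.inr h.1
    have hmono : ∀ {x y}, (fromEdgeSet E).Reachable x y →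
        (fromEdgeSet (insert s(u, v) E)).Reachable x y :=
      fun h => h.mono (fromEdgeSet_mono (Set.subset_insert _ E))
    have hadj : (fromEdgeSet (insert s(u, v) E)).Reachable u v :=
      Adj.reachable ⟨Set.mem_insert _ _, fun h => huv (h ▸ Reachable.refl _)⟩
    have hreach : (fromEdgeSet (insert s(u, v) E)).Reachable a b := by
      rcases hab u with hu | hu <;> rcases hab v with hv | hv
      · exact absurd (hu.trans hv.symm) huv
      · exact ((hmono hu).symm.trans hadj).trans (hmono hv)
      · exact ((hmono hv).symm.trans hadj.symm).trans (hmono hu)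
      · exact absurd (hu.trans hv.symm) huv
    have hxa : ∀ x, (fromEdgeSet (insert s(u, v) E)).Reachable x a := fun x =>
      (hab x).elim hmono fun h => (hmono h).trans hreach.symm
    exact ⟨fun x y => (hxa x).trans (hxa y).symm⟩

end SimpleGraph

open SimpleGraph

/-- A set of edges of the complete graph whose removal leaves a connected graph. -/
def IsCoconnected (I : Finset (Sym2 V)) : Prop :=
  (∀ e ∈ I, ¬ e.IsDiag) ∧ (fromEdgeSet (I : Set (Sym2 V))ᶜ).Connected

theorem isMatroidal_isCoconnected [DecidableEq V] :
    IsMatroidal (IsCoconnected : Finset (Sym2 V) → Prop) where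
  mono I J hIJ hJ := ⟨fun e he => hJ.1 e (hIJ he),
    hJ.2.mono (fromEdgeSet_mono (Set.compl_subset_compl.2 (Finset.coe_subset.2 hIJ)))⟩
  exchange S i j k hi hj hk hij hjk hik h₁ h₂ := by
    set E : Set (Sym2 V) := (insert i (insert j (insert k (S : Set (Sym2 V)))))ᶜ with hE
    have e₁ : ((insert j S : Finset (Sym2 V)) : Set (Sym2 V))ᶜ = insert i (insert k E) := by
      ext x; simp only [hE, Finset.coe_insert, Set.mem_compl_iff, Set.mem_insert_iff, Finset.mem_coe]
      grind
    have e₂ : ((insert i (insert k S) : Finset (Sym2 V)) : Set (Sym2 V))ᶜ = insert j E := by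
      ext x; simp only [hE, Finset.coe_insert, Set.mem_compl_iff, Set.mem_insert_iff, Finset.mem_coe]
      grind
    have e₃ : ((insert i (insert j S) : Finset (Sym2 V)) : Set (Sym2 V))ᶜ = insert k E := by
      ext x; simp only [hE, Finset.coe_insert, Set.mem_compl_iff, Set.mem_insert_iff, Finset.mem_coe]
      grind
    have e₄ : ((insert j (insert k S) : Finset (Sym2 V)) : Set (Sym2 V))ᶜ = insert i E := by
      ext x; simp only [hE, Finset.coe_insert, Set.mem_compl_iff, Set.mem_insert_iff, Finset.mem_coe]
      grind
    have c₁ := h₁.2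
    have c₂ := h₂.2
    rw [e₁] at c₁
    rw [e₂] at c₂
    refine (c₁.fromEdgeSet_insert_exchange c₂).imp (fun h => ⟨?_, e₃ ▸ h⟩) fun h => ⟨?_, e₄ ▸ h⟩
    · have := h₁.1; have := h₂.1; grind
    · have := h₁.1; have := h₂.1; grind

theorem ncard_edgeSet_add_ncard_edgeSet_compl [Finite V] (G : SimpleGraph V) :
    G.edgeSet.ncard + Gᶜ.edgeSet.ncard = (⊤ : SimpleGraph V).edgeSet.ncard := by
  rw [← Set.ncard_union_eq, ← edgeSet_sup, sup_compl_eq_top]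
  exact disjoint_edgeSet.2 disjoint_compl_right

theorem fromEdgeSet_compl_edgeSet_compl (G : SimpleGraph V) : fromEdgeSet (Gᶜ.edgeSet)ᶜ = G := by
  ext x y
  rw [fromEdgeSet_adj, Set.mem_compl_iff, mem_edgeSet, compl_adj]
  exact ⟨fun h => by tauto, fun h => ⟨fun h' => h'.2 h, h.ne⟩⟩

theorem compl_fromEdgeSet_compl_edgeSet {E : Set (Sym2 V)} (hE : ∀ e ∈ E, ¬ e.IsDiag) :
    (fromEdgeSet Eᶜ)ᶜ.edgeSet = E := by
  ext e
  induction e with | _ x y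
  have := hE s(x, y)
  rw [Sym2.mk_isDiag_iff] at this
  rw [mem_edgeSet, compl_adj, fromEdgeSet_adj, Set.mem_compl_iff]
  tauto

theorem ncard_connected_eq_ncard_isCoconnected [Finite V] {k m : ℕ}
    (hkm : k + m = (⊤ : SimpleGraph V).edgeSet.ncard) :
    {G : SimpleGraph V | G.Connected ∧ G.edgeSet.ncard = k}.ncard =
      {I : Finset (Sym2 V) | IsCoconnected I ∧ #I = m}.ncard := by
  refine Set.ncard_congr (fun G _ => (Set.toFinite Gᶜ.edgeSet).toFinset) ?_ ?_ ?_
  · rintro G ⟨hG, hcard⟩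
    have := ncard_edgeSet_add_ncard_edgeSet_compl G
    refine ⟨⟨fun e he => ?_, ?_⟩, ?_⟩
    · exact not_isDiag_of_mem_edgeSet _ ((Set.Finite.mem_toFinset _).1 he)
    · rwa [Set.Finite.coe_toFinset, fromEdgeSet_compl_edgeSet_compl]
    · rw [← Set.ncard_eq_toFinset_card]
      omega
  · intro G H _ _ h
    exact compl_injective (edgeSet_injective (Set.Finite.toFinset_inj.1 h))
  · rintro I ⟨⟨hdiag, hconn⟩, hcard⟩
    have hI := compl_fromEdgeSet_compl_edgeSet (E := (I : Set (Sym2 V))) hdiag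
    have := ncard_edgeSet_add_ncard_edgeSet_compl (fromEdgeSet (I : Set (Sym2 V))ᶜ)
    rw [hI, Set.ncard_coe_finset] at this
    refine ⟨_, ⟨hconn, by omega⟩, ?_⟩
    simp [hI]

end Connected

theorem coeff_connPoly (n k : ℕ) : (connPoly n).coeff k =
    {G : SimpleGraph (Fin n) | G.Connected ∧ G.edgeSet.ncard = k}.ncard := by
  classical
  rw [connPoly, finsum_eq_sum_of_fintype, Polynomial.finsetSum_coeff]
  simp only [Polynomial.coeff_X_pow, eq_comm (a := k), Finset.sum_boole]
  rw [← Set.ncard_coe_finset, ← Set.ncard_image_of_injective _ Subtype.val_injective]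
  congr 2
  ext G
  simp [← Set.ncard_coe_finset, and_comm]

/-- The edge enumerator of labeled connected simple graphs has log-concave coefficients for
all `n ≥ 1`. -/
theorem connPoly_logConcave (n : ℕ) (hn : 1 ≤ n) : PolyLogConcave (connPoly n) := by
  intro i
  rw [coeff_connPoly, coeff_connPoly, coeff_connPoly]
  rcases le_or_gt (i + 2) (⊤ : SimpleGraph (Fin n)).edgeSet.ncard with hle | hlt
  · obtain ⟨m, hm⟩ := Nat.exists_eq_add_of_le hle
    rw [ncard_connected_eq_ncard_isCoconnected (k := i) (m := m + 2) (by omega),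
      ncard_connected_eq_ncard_isCoconnected (k := i + 1) (m := m + 1) (by omega),
      ncard_connected_eq_ncard_isCoconnected (k := i + 2) (m := m) (by omega), mul_comm]
    exact_mod_cast isMatroidal_isCoconnected.ncard_mul_ncard_le m
  · have hempty : {G : SimpleGraph (Fin n) | G.Connected ∧ G.edgeSet.ncard = i + 2} = ∅ := by
      refine Set.eq_empty_of_forall_notMem fun G hG => ?_
      have := ncard_edgeSet_add_ncard_edgeSet_compl G
      have := hG.2
      omega
    rw [hempty, Set.ncard_empty, Nat.cast_zero, mul_zero]
    positivity
end

section
/- Let G be an undirected, loopless, connected graph on vertex set {0,1,...,n} and let P_G(x) = Σ x^{sum(a)} over all G-parking functions a = (a_1,...,a_n). Then T_{M(G)}(1, y) = y^{e(G)} P_G(1/y), where e(G) is the number of edges of G and M(G) is the graphic matroid of G. -/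
open scoped Classical in
/-- The rank, in the graphic matroid, of a finite set `S` of edges:
the largest cardinality of an acyclic subset of `S`. -/
noncomputable def graphRank {V : Type} [Fintype V] (S : Finset (Sym2 V)) : ℕ :=
  (S.powerset.filter fun A : Finset (Sym2 V) =>
    (SimpleGraph.fromEdgeSet (↑A : Set (Sym2 V))).IsAcyclic).sup Finset.card

open scoped Classical in
/-- The Tutte polynomial of the graphic matroid `M(G)` of a graph `G`:
`T(x, y) = Σ_{S ⊆ E} (x-1)^(r(E) - r(S)) * (y-1)^(|S| - r(S))`. -/
noncomputable def graphTutte {V : Type} [Fintype V] (G : SimpleGraph V) :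
    MvPolynomial (Fin 2) ℤ :=
  ∑ S ∈ G.edgeFinset.powerset,
    (MvPolynomial.X 0 - 1) ^ (graphRank G.edgeFinset - graphRank S) *
      (MvPolynomial.X 1 - 1) ^ (S.card - graphRank S)

/-- `dOut G I i` is the number of edges of `G` between the vertex `i` and vertices not in `I`. -/
noncomputable def dOut {n : ℕ} (G : SimpleGraph (Fin (n + 1))) (I : Finset (Fin (n + 1)))
    (i : Fin (n + 1)) : ℕ :=
  Nat.card {v : Fin (n + 1) // G.Adj i v ∧ v ∉ I}

/-- A `G`-parking function for a graph `G` on vertex set `{0, 1, ..., n}`: a sequence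
`(a_1, ..., a_n)` of positive integers (indexed by the nonzero vertices, `Fin.succ` of `Fin n`)
such that for every nonempty `I ⊆ {1, ..., n}` there is `i ∈ I` with `a_i ≤ d_I(i)`. -/
def IsGParkingFunction {n : ℕ} (G : SimpleGraph (Fin (n + 1))) (a : Fin n → ℕ) : Prop :=
  (∀ i, 1 ≤ a i) ∧
    ∀ I : Finset (Fin n), I.Nonempty → ∃ i ∈ I, a i ≤ dOut G (I.image Fin.succ) i.succ

section RelativeParking

open Finset
open scoped Classical

variable {V : Type} [DecidableEq V]

/-- Every vertex is joined to `B` by edges of `S`, expressed by cuts: each nonempty set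
of vertices avoiding `B` has an edge of `S` leaving it. -/
def ConnectedTo (S : Finset (Sym2 V)) (B : Finset V) : Prop :=
  ∀ I : Finset V, I.Nonempty → Disjoint I B → ∃ i ∈ I, ∃ j ∉ I, s(i, j) ∈ S

lemma connectedTo_insert {E : Finset (Sym2 V)} {B : Finset V} {v b : V} (hb : b ∈ B) :
    ConnectedTo (insert s(v, b) E) B ↔ ConnectedTo E (insert v B) := by
  constructor
  · intro h I hI hd
    rw [disjoint_insert_right] at hd
    obtain ⟨i, hi, j, hj, hij⟩ := h I hI hd.2
    refine ⟨i, hi, j, hj, ?_⟩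
    have hiv : i ≠ v := fun h => hd.1 (h ▸ hi)
    have hib : i ≠ b := fun h => disjoint_left.1 hd.2 hi (h ▸ hb)
    simpa [hiv, hib] using hij
  · intro h I hI hd
    by_cases hvI : v ∈ I
    · exact ⟨v, hvI, b, fun hbI => disjoint_left.1 hd hbI hb, by simp⟩
    · obtain ⟨i, hi, j, hj, hij⟩ := h I hI (disjoint_insert_right.2 ⟨hvI, hd⟩)
      exact ⟨i, hi, j, hj, mem_insert_of_mem hij⟩

/-- The generating function of edge sets connecting every vertex to `B`. -/
noncomputable def connectedSum {R : Type*} [CommRing R] (z : R) (E : Finset (Sym2 V))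
    (B : Finset V) : R :=
  ∑ S ∈ E.powerset, if ConnectedTo S B then z ^ #S else 0

lemma connectedSum_insert {R : Type*} [CommRing R] (z : R) {E : Finset (Sym2 V)} {B : Finset V}
    {v b : V} (he : s(v, b) ∉ E) (hb : b ∈ B) :
    connectedSum z (insert s(v, b) E) B =
      connectedSum z E B + z * connectedSum z E (insert v B) := by
  unfold connectedSum
  rw [sum_powerset_insert he, mul_sum]
  congr 1
  refine sum_congr rfl fun S hS => ?_
  have hS' : s(v, b) ∉ S := fun h => he (mem_powerset.1 hS h)
  simp [connectedTo_insert hb, card_insert_of_notMem hS', pow_succ']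

variable [Fintype V]

/-- The number of edges of `E` joining `i` to a vertex outside `I`. -/
noncomputable def outDegree (E : Finset (Sym2 V)) (I : Finset V) (i : V) : ℕ :=
  #{j | j ∉ I ∧ s(i, j) ∈ E}

/-- Parking functions of the graph with edge set `E` whose root is the contracted set `B`,
extended by zero to `B`. -/
def IsParkingRel (E : Finset (Sym2 V)) (B : Finset V) (a : V → ℕ) : Prop :=
  (∀ i, a i = 0 ↔ i ∈ B) ∧
    ∀ I : Finset V, I.Nonempty → Disjoint I B → ∃ i ∈ I, a i ≤ outDegree E I i

lemma IsParkingRel.le_card {E : Finset (Sym2 V)} {B : Finset V} {a : V → ℕ}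
    (h : IsParkingRel E B a) (i : V) : a i ≤ Fintype.card V := by
  by_cases hi : i ∈ B
  · simp [(h.1 i).2 hi]
  · obtain ⟨j, hj, hle⟩ := h.2 {i} (by simp) (by simpa using hi)
    rw [mem_singleton] at hj
    subst hj
    exact hle.trans (card_le_univ _)

/-- The finite set of parking functions relative to `B`. -/
noncomputable def parkingRel (E : Finset (Sym2 V)) (B : Finset V) : Finset (V → ℕ) :=
  (Fintype.piFinset fun _ => range (Fintype.card V + 1)).filter (IsParkingRel E B)

@[simp]
lemma mem_parkingRel {E : Finset (Sym2 V)} {B : Finset V} {a : V → ℕ} :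
    a ∈ parkingRel E B ↔ IsParkingRel E B a := by
  simp only [parkingRel, mem_filter, Fintype.mem_piFinset, mem_range, and_iff_right_iff_imp]
  exact fun h i => Nat.lt_succ_of_le (h.le_card i)

section Insert

variable {E : Finset (Sym2 V)} {B : Finset V} {v b : V}

lemma outDegree_insert_of_ne {I : Finset V} {i : V} (hv : i ≠ v) (hb : i ≠ b) :
    outDegree (insert s(v, b) E) I i = outDegree E I i := by
  unfold outDegree
  congr 1
  ext j
  simp [hv, hb]

lemma outDegree_insert_self (he : s(v, b) ∉ E) {I : Finset V} (hv : v ∈ I) (hb : b ∉ I) :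
    outDegree (insert s(v, b) E) I v = outDegree E I v + 1 := by
  unfold outDegree
  rw [← card_insert_of_notMem (a := b) (by simp [he])]
  congr 1
  ext j
  have : b ≠ v := fun h => hb (h ▸ hv)
  simp only [mem_filter, mem_univ, true_and, mem_insert, Sym2.eq_iff]
  grind

lemma isParkingRel_insert_update_one (he : s(v, b) ∉ E) (hv : v ∉ B) (hb : b ∈ B) {a : V → ℕ} :
    IsParkingRel (insert s(v, b) E) B (Function.update a v 1) ↔
      IsParkingRel E (insert v B) (Function.update a v 0) := by
  refine and_congr (forall_congr' fun i => ?_) ⟨fun h I hI hd => ?_, fun h I hI hd => ?_⟩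
  · by_cases hi : i = v
    · subst hi; simp [hv]
    · simp [hi]
  · rw [disjoint_insert_right] at hd
    obtain ⟨i, hi, hle⟩ := h I hI hd.2
    have hiv : i ≠ v := fun h => hd.1 (h ▸ hi)
    have hib : i ≠ b := fun h => disjoint_left.1 hd.2 hi (h ▸ hb)
    rw [outDegree_insert_of_ne hiv hib] at hle
    exact ⟨i, hi, by simpa [hiv] using hle⟩
  · have hbI : b ∉ I := fun hbI => disjoint_left.1 hd hbI hb
    by_cases hvI : v ∈ I
    · exact ⟨v, hvI, by simp [outDegree_insert_self he hvI hbI]⟩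
    · obtain ⟨i, hi, hle⟩ := h I hI (disjoint_insert_right.2 ⟨hvI, hd⟩)
      have hiv : i ≠ v := fun h => hvI (h ▸ hi)
      have hib : i ≠ b := fun h => hbI (h ▸ hi)
      exact ⟨i, hi, by simpa [hiv, outDegree_insert_of_ne hiv hib] using hle⟩

lemma isParkingRel_insert_update_succ (he : s(v, b) ∉ E) (hv : v ∉ B) (hb : b ∈ B) {a : V → ℕ}
    (ha : a v ≠ 0) :
    IsParkingRel (insert s(v, b) E) B (Function.update a v (a v + 1)) ↔ IsParkingRel E B a := by
  refine and_congr (forall_congr' fun i => ?_) (forall_congr' fun I => forall_congr' fun _ =>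
    forall_congr' fun hd => exists_congr fun i => and_congr_right fun hi => ?_)
  · by_cases hi : i = v
    · subst hi; simp [hv, ha]
    · simp [hi]
  · have hbI : b ∉ I := fun hbI => disjoint_left.1 hd hbI hb
    by_cases hiv : i = v
    · subst hiv
      simp [outDegree_insert_self he hi hbI]
    · have hib : i ≠ b := fun h => hbI (h ▸ hi)
      simp [hiv, outDegree_insert_of_ne hiv hib]

end Insert

/-- The Laurent polynomial `∑ y ^ (#E - ∑ a)` over parking functions relative to `B`. -/
noncomputable def parkingSum (E : Finset (Sym2 V)) (B : Finset V) : LaurentPolynomial ℤ :=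
  ∑ a ∈ parkingRel E B, LaurentPolynomial.T ((#E : ℤ) - ((∑ i, a i : ℕ) : ℤ))

lemma parkingSum_insert {E : Finset (Sym2 V)} {B : Finset V} {v b : V} (he : s(v, b) ∉ E)
    (hv : v ∉ B) (hb : b ∈ B) :
    parkingSum (insert s(v, b) E) B = parkingSum E B + parkingSum E (insert v B) := by
  unfold parkingSum
  rw [← sum_filter_add_sum_filter_not _ (fun a : V → ℕ => a v ≠ 1)]
  have hsum : ∀ (a : V → ℕ) (k : ℕ),
      (∑ i, Function.update a v k i) + a v = (∑ i, a i) + k := by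
    intro a k
    rw [sum_update_of_mem (mem_univ v), ← add_sum_erase univ a (mem_univ v),
      ← sdiff_singleton_eq_erase]
    ring
  congr 1
  · refine sum_bij' (fun a _ => Function.update a v (a v - 1))
      (fun a _ => Function.update a v (a v + 1)) ?_ ?_ ?_ ?_ ?_
    · intro a ha
      simp only [mem_filter, mem_parkingRel] at ha
      have h0 : a v ≠ 0 := fun h => hv ((ha.1.1 v).1 h)
      have h1 := ha.2
      rw [mem_parkingRel, ← isParkingRel_insert_update_succ he hv hb (by simp; omega)]
      have : a v - 1 + 1 = a v := by omega
      simpa [this] using ha.1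
    · intro a ha
      rw [mem_parkingRel] at ha
      have h0 : a v ≠ 0 := fun h => hv ((ha.1 v).1 h)
      simpa [isParkingRel_insert_update_succ he hv hb h0, h0] using ha
    · intro a ha
      simp only [mem_filter, mem_parkingRel] at ha
      have h0 : a v ≠ 0 := fun h => hv ((ha.1.1 v).1 h)
      have : a v - 1 + 1 = a v := by omega
      simp [this]
    · intro a _
      simp
    · intro a ha
      simp only [mem_filter, mem_parkingRel] at ha
      have h0 : a v ≠ 0 := fun h => hv ((ha.1.1 v).1 h)
      have := hsum a (a v - 1)
      congr 1
      rw [card_insert_of_notMem he]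
      omega
  · refine sum_bij' (fun a _ => Function.update a v 0)
      (fun a _ => Function.update a v 1) ?_ ?_ ?_ ?_ ?_
    · intro a ha
      simp only [mem_filter, mem_parkingRel, not_not] at ha
      rw [mem_parkingRel, ← isParkingRel_insert_update_one he hv hb, ← ha.2,
        Function.update_eq_self]
      exact ha.1
    · intro a ha
      rw [mem_parkingRel] at ha
      have h0 : a v = 0 := (ha.1 v).2 (mem_insert_self v B)
      simp only [mem_filter, mem_parkingRel, not_not, isParkingRel_insert_update_one he hv hb,
        Function.update_self, and_true]
      rwa [← h0, Function.update_eq_self]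
    · intro a ha
      simp only [mem_filter, not_not] at ha
      simp [← ha.2]
    · intro a ha
      rw [mem_parkingRel] at ha
      have h0 : a v = 0 := (ha.1 v).2 (mem_insert_self v B)
      simp [← h0]
    · intro a ha
      simp only [mem_filter, not_not] at ha
      have := hsum a 0
      congr 1
      rw [card_insert_of_notMem he]
      omega

lemma connectedSum_eq_parkingSum_univ (E : Finset (Sym2 V)) :
    connectedSum (LaurentPolynomial.T 1 - 1 : LaurentPolynomial ℤ) E univ =
      (LaurentPolynomial.T 1 - 1) ^ #(univ : Finset V)ᶜ * parkingSum E univ := by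
  have hconn : ∀ S : Finset (Sym2 V), ConnectedTo S univ := by
    rintro S I ⟨i, hi⟩ hd
    exact absurd (mem_univ i) (disjoint_left.1 hd hi)
  have hpark : parkingRel E univ = {0} := by
    ext a
    rw [mem_parkingRel, mem_singleton]
    refine ⟨fun h => funext fun i => (h.1 i).2 (mem_univ i), ?_⟩
    rintro rfl
    exact ⟨by simp, fun I ⟨i, hi⟩ _ => ⟨i, hi, by simp⟩⟩
  have hbinom := sum_pow_mul_eq_add_pow (LaurentPolynomial.T 1 - 1 : LaurentPolynomial ℤ) 1 E
  simp only [one_pow, mul_one, sub_add_cancel, LaurentPolynomial.T_pow] at hbinom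
  simpa [connectedSum, parkingSum, hconn, hpark] using hbinom

/-- Both sides satisfy the same recursion when an edge between `B` and its complement is removed. -/
theorem connectedSum_eq_parkingSum (E : Finset (Sym2 V)) (B : Finset V) :
    connectedSum (LaurentPolynomial.T 1 - 1 : LaurentPolynomial ℤ) E B =
      (LaurentPolynomial.T 1 - 1) ^ #Bᶜ * parkingSum E B := by
  induction E using Finset.strongInduction generalizing B with
  | H E ih =>
    by_cases hcut : ∃ v ∉ B, ∃ b ∈ B, s(v, b) ∈ E
    · obtain ⟨v, hv, b, hb, he⟩ := hcut
      have he' : s(v, b) ∉ E.erase s(v, b) := notMem_erase _ _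
      have hcard : #Bᶜ = #(insert v B)ᶜ + 1 := by
        rw [compl_insert, card_erase_add_one (mem_compl.2 hv)]
      rw [← insert_erase he, connectedSum_insert _ he' hb, parkingSum_insert he' hv hb,
        ih _ (erase_ssubset he), ih _ (erase_ssubset he), hcard]
      ring
    · push Not at hcut
      obtain rfl | hB := eq_or_ne B univ
      · exact connectedSum_eq_parkingSum_univ E
      · have hne : Bᶜ.Nonempty := by
          rwa [nonempty_iff_ne_empty, ne_eq, compl_eq_empty_iff]
        have hd : Disjoint Bᶜ B := disjoint_compl_left
        have hpark : parkingRel E B = ∅ := by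
          refine eq_empty_of_forall_notMem fun a ha => ?_
          rw [mem_parkingRel] at ha
          obtain ⟨i, hi, hle⟩ := ha.2 _ hne hd
          have h0 : outDegree E Bᶜ i = 0 := by
            simp only [outDegree, card_eq_zero, filter_eq_empty_iff]
            rintro j - ⟨hj, hij⟩
            exact hcut i (mem_compl.1 hi) j (by simpa using hj) hij
          rw [h0, Nat.le_zero] at hle
          exact mem_compl.1 hi ((ha.1 i).1 hle)
        have hconn : ∀ S ∈ E.powerset, ¬ ConnectedTo S B := by
          intro S hS h
          obtain ⟨i, hi, j, hj, hij⟩ := h _ hne hd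
          exact hcut i (mem_compl.1 hi) j (by simpa using hj) (mem_powerset.1 hS hij)
        rw [parkingSum, hpark, sum_empty, mul_zero, connectedSum]
        exact sum_eq_zero fun S hS => if_neg (hconn S hS)

lemma connectedTo_singleton_iff {S : Finset (Sym2 V)} {r : V} :
    ConnectedTo S {r} ↔ (SimpleGraph.fromEdgeSet (S : Set (Sym2 V))).Connected := by
  constructor
  · intro h
    rw [SimpleGraph.connected_iff_exists_forall_reachable]
    refine ⟨r, fun w => ?_⟩
    by_contra hw
    obtain ⟨i, hi, j, hj, hij⟩ :=
      h {u | ¬ (SimpleGraph.fromEdgeSet (S : Set (Sym2 V))).Reachable r u}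
        ⟨w, by simpa using hw⟩ (by simp)
    simp only [mem_filter, mem_univ, true_and, not_not] at hi hj
    refine hi (hj.trans (SimpleGraph.Adj.reachable ?_))
    rw [SimpleGraph.fromEdgeSet_adj, Sym2.eq_swap]
    exact ⟨hij, fun h => hi (h ▸ hj)⟩
  · rintro h I ⟨u, hu⟩ hd
    obtain ⟨p⟩ := h.preconnected u r
    obtain ⟨d, -, hd1, hd2⟩ := p.exists_boundary_dart (I : Set V) hu
      (by simpa using hd)
    exact ⟨d.fst, hd1, d.snd, hd2, (SimpleGraph.fromEdgeSet_adj _ |>.1 d.adj).1⟩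

end RelativeParking

section Rank

open Finset

variable {V : Type} [Fintype V]

lemma graphRank_le_card (S : Finset (Sym2 V)) : graphRank S ≤ #S := by
  classical
  exact Finset.sup_le fun A hA => card_le_card (mem_powerset.1 (mem_filter.1 hA).1)

lemma exists_card_eq_graphRank (S : Finset (Sym2 V)) : ∃ A ⊆ S,
    (SimpleGraph.fromEdgeSet (A : Set (Sym2 V))).IsAcyclic ∧ #A = graphRank S := by
  classical
  obtain ⟨A, hA, h⟩ := exists_mem_eq_sup (S.powerset.filter fun A : Finset (Sym2 V) =>
    (SimpleGraph.fromEdgeSet (A : Set (Sym2 V))).IsAcyclic) ⟨∅, by simp⟩ card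
  simp only [mem_filter, mem_powerset] at hA
  exact ⟨A, hA.1, hA.2, by rw [graphRank, ← h]⟩

lemma card_le_graphRank {A S : Finset (Sym2 V)} (hAS : A ⊆ S)
    (hA : (SimpleGraph.fromEdgeSet (A : Set (Sym2 V))).IsAcyclic) : #A ≤ graphRank S := by
  classical
  exact le_sup (f := card) (mem_filter.2 ⟨mem_powerset.2 hAS, hA⟩)

variable [Nonempty V] {S : Finset (Sym2 V)}

lemma exists_isTree_of_isAcyclic {A : Finset (Sym2 V)} (hd : ∀ e ∈ A, ¬ e.IsDiag)
    (hA : (SimpleGraph.fromEdgeSet (A : Set (Sym2 V))).IsAcyclic) :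
    ∃ F : Finset (Sym2 V), A ⊆ F ∧
      (SimpleGraph.fromEdgeSet (F : Set (Sym2 V))).IsTree ∧ #F + 1 = Fintype.card V := by
  classical
  obtain ⟨F, hAF, -, hF⟩ :=
    SimpleGraph.connected_top.exists_isTree_le_of_le_of_isAcyclic le_top hA
  refine ⟨F.edgeFinset, fun e he => ?_, by simpa using hF, hF.card_edgeFinset⟩
  rw [SimpleGraph.mem_edgeFinset]
  exact SimpleGraph.edgeSet_mono hAF (by simpa using ⟨he, hd e he⟩)

lemma graphRank_lt_card (hd : ∀ e ∈ S, ¬ e.IsDiag) : graphRank S + 1 ≤ Fintype.card V := by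
  obtain ⟨A, hAS, hA, hcard⟩ := exists_card_eq_graphRank S
  obtain ⟨F, hAF, -, hF⟩ := exists_isTree_of_isAcyclic (fun e he => hd e (hAS he)) hA
  have := card_le_card hAF
  omega

lemma graphRank_eq_iff_connected (hd : ∀ e ∈ S, ¬ e.IsDiag) :
    graphRank S + 1 = Fintype.card V ↔
      (SimpleGraph.fromEdgeSet (S : Set (Sym2 V))).Connected := by
  classical
  constructor
  · intro h
    obtain ⟨A, hAS, hA, hcard⟩ := exists_card_eq_graphRank S
    obtain ⟨F, hAF, hT, hF⟩ := exists_isTree_of_isAcyclic (fun e he => hd e (hAS he)) hA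
    obtain rfl : A = F := eq_of_subset_of_card_le hAF (by omega)
    exact hT.connected.mono (SimpleGraph.fromEdgeSet_mono (by exact_mod_cast hAS))
  · intro h
    obtain ⟨T, hTS, hT⟩ := h.exists_isTree_le
    refine le_antisymm (graphRank_lt_card hd) ?_
    rw [← hT.card_edgeFinset, Nat.add_le_add_iff_right]
    refine card_le_graphRank (fun e he => ?_) (by simpa using hT.isAcyclic)
    have := SimpleGraph.edgeSet_mono hTS (SimpleGraph.mem_edgeFinset.1 he)
    simp only [SimpleGraph.edgeSet_fromEdgeSet] at this
    exact this.1

end Rank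

section Fin

open Finset

variable {n : ℕ} (G : SimpleGraph (Fin (n + 1))) [Fintype G.edgeSet]

lemma dOut_eq_outDegree (I : Finset (Fin (n + 1))) (i : Fin (n + 1)) :
    dOut G I i = outDegree G.edgeFinset I i := by
  classical
  rw [dOut, outDegree, Nat.card_eq_fintype_card, Fintype.card_subtype]
  congr 1
  ext j
  simp [and_comm]

lemma isParkingRel_cons_zero {a : Fin n → ℕ} :
    IsParkingRel G.edgeFinset {0} (Fin.cons 0 a : Fin (n + 1) → ℕ) ↔ IsGParkingFunction G a := by
  refine and_congr ?_ ⟨fun h I hI => ?_, fun h I hI hd => ?_⟩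
  · rw [Fin.forall_fin_succ]
    simp [Nat.one_le_iff_ne_zero]
  · obtain ⟨i, hi, hle⟩ := h (I.image Fin.succ) (hI.image _) (by simp)
    obtain ⟨j, hj, rfl⟩ := mem_image.1 hi
    exact ⟨j, hj, by simpa [dOut_eq_outDegree] using hle⟩
  · rw [disjoint_singleton_right] at hd
    have himage : ({j | j.succ ∈ I} : Finset (Fin n)).image Fin.succ = I := by
      ext i
      cases i using Fin.cases <;> simp [hd]
    have hne : ({j | j.succ ∈ I} : Finset (Fin n)).Nonempty := by
      rwa [← image_nonempty (f := Fin.succ), himage]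
    obtain ⟨j, hj, hle⟩ := h _ hne
    rw [himage, dOut_eq_outDegree] at hle
    exact ⟨j.succ, by simpa using hj, by simpa using hle⟩

lemma parkingSum_eq_finsum :
    parkingSum G.edgeFinset {0} = LaurentPolynomial.T (#G.edgeFinset : ℤ) *
      ∑ᶠ a : {a : Fin n → ℕ // IsGParkingFunction G a},
        (LaurentPolynomial.T (-((∑ i, a.1 i : ℕ) : ℤ)) : LaurentPolynomial ℤ) := by
  have hfin : ∑ᶠ a : {a : Fin n → ℕ // IsGParkingFunction G a},
      (LaurentPolynomial.T (-((∑ i, a.1 i : ℕ) : ℤ)) : LaurentPolynomial ℤ) =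
      ∑ a ∈ parkingRel G.edgeFinset {0}, LaurentPolynomial.T (-((∑ i, a i : ℕ) : ℤ)) := by
    rw [← finsum_mem_coe_finset]
    refine (finsum_set_coe_eq_finsum_mem (f := fun a : Fin n → ℕ =>
      (LaurentPolynomial.T (-((∑ i, a i : ℕ) : ℤ)) : LaurentPolynomial ℤ))
      {a : Fin n → ℕ | IsGParkingFunction G a}).trans
      (finsum_mem_eq_of_bijOn (fun a => (Fin.cons 0 a : Fin (n + 1) → ℕ)) ⟨?_, ?_, ?_⟩ ?_)
    · intro a ha
      simpa [isParkingRel_cons_zero] using ha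
    · intro a _ a' _ h
      exact Fin.cons_right_injective _ h
    · intro a ha
      rw [mem_coe, mem_parkingRel] at ha
      have h0 : a 0 = 0 := (ha.1 0).2 (mem_singleton_self 0)
      have hcons : (Fin.cons 0 (Fin.tail a) : Fin (n + 1) → ℕ) = a := by
        rw [← h0, Fin.cons_self_tail]
      exact ⟨Fin.tail a, (isParkingRel_cons_zero G).1 (hcons ▸ ha), hcons⟩
    · intro a _
      simp [Fin.sum_univ_succ]
  rw [hfin, parkingSum, mul_sum]
  exact sum_congr rfl fun a _ => by rw [← LaurentPolynomial.T_add, sub_eq_add_neg]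

end Fin

open scoped Classical in
/-- For a loopless connected graph `G` on `{0, ..., n}`, the Tutte polynomial specialization
satisfies `T_{M(G)}(1, y) = y^(e(G)) * P_G(1/y)` (as Laurent polynomials). -/
theorem tutte_eq_gpf (n : ℕ) (G : SimpleGraph (Fin (n + 1))) (hG : G.Connected) :
    MvPolynomial.aeval
        ![(1 : LaurentPolynomial ℤ), LaurentPolynomial.T 1] (graphTutte G) =
      LaurentPolynomial.T (G.edgeFinset.card : ℤ) *
        ∑ᶠ a : {a : Fin n → ℕ // IsGParkingFunction G a},
          (LaurentPolynomial.T (-((∑ i, a.1 i : ℕ) : ℤ)) : LaurentPolynomial ℤ) := by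
  set z : LaurentPolynomial ℤ := LaurentPolynomial.T 1 - 1 with hz
  have hz0 : z ≠ 0 := by
    have hX : z = Polynomial.toLaurent (Polynomial.X - Polynomial.C 1) := by simp [hz]
    rw [hX]
    exact Polynomial.toLaurent_ne_zero.2 (Polynomial.X_sub_C_ne_zero 1)
  rw [← parkingSum_eq_finsum]
  refine mul_left_cancel₀ (pow_ne_zero n hz0) ?_
  have hcompl : ({0} : Finset (Fin (n + 1)))ᶜ.card = n := by simp [Finset.card_compl]
  have hmain := connectedSum_eq_parkingSum G.edgeFinset {0}
  rw [hcompl] at hmain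
  rw [← hmain, graphTutte, map_sum, Finset.mul_sum, connectedSum]
  have hdiag : ∀ S ⊆ G.edgeFinset, ∀ e ∈ S, ¬ e.IsDiag := fun S hS e he =>
    G.not_isDiag_of_mem_edgeSet (SimpleGraph.mem_edgeFinset.1 (hS he))
  have hrankG : graphRank G.edgeFinset = n := by
    have := (graphRank_eq_iff_connected (hdiag _ subset_rfl)).2 (by simpa using hG)
    simpa using this
  refine Finset.sum_congr rfl fun S hS => ?_
  have hSd := hdiag S (Finset.mem_powerset.1 hS)
  have hle : graphRank S ≤ n := by simpa using graphRank_lt_card hSd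
  have hconn : ConnectedTo S {(0 : Fin (n + 1))} ↔ graphRank S = n := by
    rw [connectedTo_singleton_iff, ← graphRank_eq_iff_connected hSd]
    simp
  rw [hrankG]
  split_ifs with h
  · have hr := hconn.1 h
    have hc := graphRank_le_card S
    rw [hr] at hc ⊢
    simp [← hz, ← pow_add, Nat.add_sub_cancel' hc]
  · have hr : n - graphRank S ≠ 0 := fun h' => h (hconn.2 (by omega))
    simp [zero_pow hr]
end
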